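/- arXiv:1112.3193 — 2 statements merged into one kernel-verified Lean document; each statement's English description precedes it below -/
import Mathlib

section
/- Let G be a graph and x an eigenvector of G for eigenvalue λ. Let C be a connected component of the induced subgraph G[supp(x)]. Then the restriction x|_C of x to the vertices of C satisfies A_C (x|_C) = λ (x|_C), where A_C is the adjacency matrix of C; in particular x|_C is an eigenvector of C for λ. If moreover G is a tree, then the λ-eigenspace of C is one-dimensional and is spanned by x|_C. -/
open SimpleGraph

open scoped Classical

/-- The real adjacency matrix of a simple graph. -/
noncomputable def adjMat {V : Type*} (G : SimpleGraph V) : Matrix V V ℝ :=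
  fun u v => if G.Adj u v then 1 else 0

/-- The eigenspace `{x : A x = μ x}` of the adjacency matrix of `G`. -/
noncomputable def eigSpace {V : Type*} [Fintype V] (G : SimpleGraph V) (μ : ℝ) :
    Submodule ℝ (V → ℝ) :=
  LinearMap.ker ((adjMat G).mulVecLin - μ • LinearMap.id)

/-- `x` is an eigenvector of `G` for eigenvalue `μ`. -/
def IsEigenvector {V : Type*} [Fintype V] (G : SimpleGraph V) (μ : ℝ) (x : V → ℝ) : Prop :=
  x ≠ 0 ∧ (adjMat G).mulVec x = μ • x

/-- `N_μ(G)`: vertices on which every eigenvector of `G` for `μ` vanishes. -/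
def nSet {V : Type*} [Fintype V] (G : SimpleGraph V) (μ : ℝ) : Set V :=
  {v | ∀ x : V → ℝ, IsEigenvector G μ x → x v = 0}

/-- `N^C_μ(G)`: vertices of `N_μ(G)` with a neighbor outside `N_μ(G)`. -/
def ncSet {V : Type*} [Fintype V] (G : SimpleGraph V) (μ : ℝ) : Set V :=
  {v | v ∈ nSet G μ ∧ ∃ w, G.Adj v w ∧ w ∉ nSet G μ}

/-- `C` is the vertex set of a connected component of the induced subgraph `G[S]`. -/
def IsCompOf {V : Type*} (G : SimpleGraph V) (S C : Set V) : Prop :=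
  ∃ c : (G.induce S).ConnectedComponent, C = Subtype.val '' c.supp

theorem adjMat_mulVec_apply {V : Type*} [Fintype V] (G : SimpleGraph V) (x : V → ℝ) (a : V) :
    (adjMat G).mulVec x a = ∑ b, if G.Adj a b then x b else 0 := by
  simp [Matrix.mulVec, dotProduct, adjMat]

theorem mem_eigSpace {V : Type*} [Fintype V] {G : SimpleGraph V} {μ : ℝ} {x : V → ℝ} :
    x ∈ eigSpace G μ ↔ (adjMat G).mulVec x = μ • x := by
  simp [eigSpace, sub_eq_zero]

/-- A divergence-free flow on an acyclic graph vanishes. -/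
theorem flow_eq_zero_of_isAcyclic {V : Type*} [Fintype V] {G : SimpleGraph V} (hG : G.IsAcyclic)
    (g : V → V → ℝ) (hanti : ∀ a b, g a b = -g b a) (hsupp : ∀ a b, ¬ G.Adj a b → g a b = 0)
    (hdiv : ∀ a, ∑ b, g a b = 0) (u v : V) : g u v = 0 := by
  by_cases huv : G.Adj u v
  swap
  · exact hsupp u v huv
  have hbridge : ¬ (G.deleteEdges {s(u, v)}).Reachable u v :=
    isBridge_iff.1 (isAcyclic_iff_forall_adj_isBridge.1 hG huv)
  let S : Finset V := Finset.univ.filter fun w => (G.deleteEdges {s(u, v)}).Reachable u w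
  have huS : u ∈ S := by simp [S]
  have hvS : v ∉ S := by simpa [S] using hbridge
  have hinner : ∑ a ∈ S, ∑ b ∈ S, g a b = 0 := by
    have h : ∑ a ∈ S, ∑ b ∈ S, g a b = -∑ a ∈ S, ∑ b ∈ S, g a b := by
      conv_lhs => rw [Finset.sum_comm]
      simp_rw [← Finset.sum_neg_distrib]
      exact Finset.sum_congr rfl fun a _ => Finset.sum_congr rfl fun b _ => hanti b a
    linarith
  have hcross : ∀ a ∈ S, ∀ b ∈ Sᶜ, ¬ (a = u ∧ b = v) → g a b = 0 := by
    intro a ha b hb hne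
    apply hsupp
    intro hab
    have hb' : ¬ (G.deleteEdges {s(u, v)}).Reachable u b := by simpa [S] using hb
    have ha' : (G.deleteEdges {s(u, v)}).Reachable u a := by simpa [S] using ha
    refine hb' (ha'.trans (Adj.reachable ?_))
    rw [deleteEdges_adj]
    refine ⟨hab, ?_⟩
    rw [Set.mem_singleton_iff, Sym2.eq_iff]
    rintro (h | ⟨rfl, rfl⟩)
    · exact hne h
    · exact hvS ha
  have houter : ∑ a ∈ S, ∑ b ∈ Sᶜ, g a b = g u v := by
    rw [Finset.sum_eq_single_of_mem u huS, Finset.sum_eq_single_of_mem v (by simpa using hvS)]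
    · exact fun b hb hbv => hcross u huS b hb fun h => hbv h.2
    · exact fun a ha hau => Finset.sum_eq_zero fun b hb => hcross a ha b hb fun h => hau h.1
  have htotal : ∑ a ∈ S, ∑ b, g a b = 0 := Finset.sum_eq_zero fun a _ => hdiv a
  simp_rw [← Finset.sum_add_sum_compl S (g _)] at htotal
  rw [Finset.sum_add_distrib, hinner, houter, zero_add] at htotal
  exact htotal

/-- Two eigenvectors of an acyclic graph for the same eigenvalue have vanishing
`2 × 2` minors along edges. -/
theorem mul_eq_mul_of_adj {V : Type*} [Fintype V] {G : SimpleGraph V} (hG : G.IsAcyclic)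
    {μ : ℝ} {y z : V → ℝ} (hy : (adjMat G).mulVec y = μ • y) (hz : (adjMat G).mulVec z = μ • z)
    {u v : V} (huv : G.Adj u v) : y u * z v = y v * z u := by
  have h := flow_eq_zero_of_isAcyclic hG
    (fun a b => if G.Adj a b then y a * z b - y b * z a else 0) ?_ ?_ ?_ u v
  · simp only [huv, if_true] at h
    linarith
  · intro a b
    simp only [G.adj_comm b a]
    split_ifs <;> ring
  · intro a b hab
    simp [hab]
  · intro a
    have hya := congrFun hy a
    have hza := congrFun hz a
    rw [adjMat_mulVec_apply, Pi.smul_apply, smul_eq_mul] at hya hza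
    calc ∑ b, (if G.Adj a b then y a * z b - y b * z a else 0)
        = y a * (∑ b, if G.Adj a b then z b else 0)
          - (∑ b, if G.Adj a b then y b else 0) * z a := by
          rw [Finset.mul_sum, Finset.sum_mul, ← Finset.sum_sub_distrib]
          refine Finset.sum_congr rfl fun b _ => ?_
          split_ifs <;> ring
      _ = 0 := by
          rw [hya, hza]
          ring

/-- On a tree, an eigenvector without zero entries spans its eigenspace. -/
theorem eigSpace_eq_span_of_isTree {V : Type*} [Fintype V] {G : SimpleGraph V} (hG : G.IsTree)
    {μ : ℝ} {y : V → ℝ} (hy : (adjMat G).mulVec y = μ • y) (hne : ∀ v, y v ≠ 0) :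
    eigSpace G μ = Submodule.span ℝ {y} := by
  apply le_antisymm
  · intro z hz
    rw [mem_eigSpace] at hz
    obtain ⟨r⟩ := hG.connected.nonempty
    have hratio : ∀ v, z r / y r = z v / y v := by
      intro v
      obtain ⟨p⟩ := hG.connected.preconnected r v
      induction p with
      | nil => rfl
      | cons h _ ih =>
        rw [← ih, div_eq_div_iff (hne _) (hne _)]
        linarith [mul_eq_mul_of_adj hG.isAcyclic hy hz h]
    rw [Submodule.mem_span_singleton]
    refine ⟨z r / y r, funext fun v => ?_⟩
    rw [Pi.smul_apply, smul_eq_mul, hratio v, div_mul_cancel₀ _ (hne v)]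
  · rw [Submodule.span_singleton_le_iff_mem, mem_eigSpace]
    exact hy

namespace IsCompOf

variable {V : Type*} {G : SimpleGraph V} {S C : Set V}

theorem subset (hC : IsCompOf G S C) : C ⊆ S := by
  obtain ⟨c, rfl⟩ := hC
  rintro _ ⟨a, _, rfl⟩
  exact a.2

theorem mem_of_adj (hC : IsCompOf G S C) {a b : V} (ha : a ∈ C) (hb : b ∈ S) (hab : G.Adj a b) :
    b ∈ C := by
  obtain ⟨c, rfl⟩ := hC
  obtain ⟨a, ha, rfl⟩ := ha
  exact ⟨⟨b, hb⟩, c.mem_supp_of_adj_mem_supp ha (by simpa using hab), rfl⟩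

theorem induce_connected (hC : IsCompOf G S C) : (G.induce C).Connected := by
  have hwalk : ∀ (a b : S), (G.induce S).Walk a b → ∀ (ha : a.1 ∈ C) (hb : b.1 ∈ C),
      (G.induce C).Reachable ⟨a, ha⟩ ⟨b, hb⟩ := by
    intro a b p
    induction p with
    | nil => exact fun _ _ => Reachable.refl _
    | @cons a d b h _ ih =>
      intro ha hb
      have had : G.Adj a d := h
      have hd := hC.mem_of_adj ha d.2 had
      exact (Adj.reachable (show (G.induce C).Adj ⟨a, ha⟩ ⟨d, hd⟩ from had)).trans (ih hd hb)
  obtain ⟨c, rfl⟩ := hC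
  have hne : Nonempty (Subtype.val '' c.supp : Set V) := (c.nonempty_supp.image _).to_subtype
  refine connected_iff _ |>.2 ⟨?_, hne⟩
  rintro ⟨_, a, ha, rfl⟩ ⟨_, b, hb, rfl⟩
  obtain ⟨p⟩ := ConnectedComponent.exact
    ((c.mem_supp_iff a).1 ha |>.trans ((c.mem_supp_iff b).1 hb).symm)
  exact hwalk a b p _ _

end IsCompOf

theorem stmt_1 {V : Type*} [Fintype V] (G : SimpleGraph V) (μ : ℝ) (x : V → ℝ)
    (hx : IsEigenvector G μ x) (C : Set V)
    (hC : IsCompOf G {v | x v ≠ 0} C) :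
    (adjMat (G.induce C)).mulVec (C.restrict x) = μ • C.restrict x ∧
      (G.IsTree →
        eigSpace (G.induce C) μ = Submodule.span ℝ {C.restrict x} ∧
          Module.finrank ℝ (eigSpace (G.induce C) μ) = 1) := by
  have hy : (adjMat (G.induce C)).mulVec (C.restrict x) = μ • C.restrict x := by
    funext a
    have hxa := congrFun hx.2 a.1
    rw [adjMat_mulVec_apply] at hxa
    rw [adjMat_mulVec_apply]
    refine Eq.trans ?_ hxa
    refine Finset.sum_of_injOn Subtype.val Subtype.val_injective.injOn (by simp) ?_ (fun _ _ => rfl)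
    intro b _ hb
    have hbC : b ∉ C := by simpa using hb
    rw [ite_eq_right_iff]
    intro hab
    by_contra hxb
    exact hbC (hC.mem_of_adj a.2 hxb hab)
  refine ⟨hy, fun hG => ?_⟩
  have hne : ∀ v, C.restrict x v ≠ 0 := fun v => hC.subset v.2
  have hconn := hC.induce_connected
  have hspan := eigSpace_eq_span_of_isTree ⟨hconn, hG.isAcyclic.induce C⟩ hy hne
  refine ⟨hspan, ?_⟩
  rw [hspan]
  obtain ⟨r⟩ := hconn.nonempty
  exact finrank_span_singleton fun h => hne r (congrFun h r)
end

section
/- Let T be a tree, λ an eigenvalue of T, and x an eigenvector of T for λ. Then for every connected component C of T[V(T) \ N^C_λ(T)], the restriction x|_C either has only zero entries or has only nonzero entries; in the latter case, the λ-eigenspace of the induced subgraph on C is one-dimensional and spanned by x|_C. -/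
open SimpleGraph

open scoped Classical

/-- A flow on an acyclic graph without sources or sinks vanishes. -/
lemma SimpleGraph.IsAcyclic.flow_eq_zero {W : Type*} [Fintype W] {H : SimpleGraph W}
    (hH : H.IsAcyclic) (f : W → W → ℝ) (hanti : ∀ a b, f a b = -f b a)
    (hsupp : ∀ a b, ¬ H.Adj a b → f a b = 0) (hdiv : ∀ a, ∑ b, f a b = 0) (a b : W) :
    f a b = 0 := by
  by_cases hab : H.Adj a b
  swap
  · exact hsupp a b hab
  have hbr := isBridge_iff.mp (isAcyclic_iff_forall_adj_isBridge.mp hH hab)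
  set K := H.deleteEdges {s(a, b)} with hK
  set D : Finset W := Finset.univ.filter (K.Reachable a) with hD
  have hDD : ∑ u ∈ D, ∑ v ∈ D, f u v = 0 := by
    have h1 : ∑ u ∈ D, ∑ v ∈ D, f u v = -∑ u ∈ D, ∑ v ∈ D, f u v := by
      conv_lhs => rw [Finset.sum_comm]
      simp only [← Finset.sum_neg_distrib]
      exact Finset.sum_congr rfl fun u _ => Finset.sum_congr rfl fun v _ => hanti v u
    linarith
  have hcut : ∑ u ∈ D, ∑ v ∈ Dᶜ, f u v = f a b := by
    have key : ∀ u ∈ D, ∀ v ∈ Dᶜ, ¬ (u = a ∧ v = b) → f u v = 0 := by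
      intro u hu v hv hne
      by_contra h
      have huv : H.Adj u v := by
        by_contra h'
        exact h (hsupp u v h')
      simp only [hD, Finset.mem_filter, Finset.mem_univ, true_and, Finset.mem_compl] at hu hv
      by_cases he : s(u, v) = s(a, b)
      · rcases Sym2.eq_iff.mp he with h2 | ⟨rfl, rfl⟩
        · exact hne h2
        · exact hbr hu
      · exact hv (hu.trans (Adj.reachable (by simpa [hK, deleteEdges_adj, huv] using he)))
    have haD : a ∈ D := by simp [hD]
    have hbD : b ∈ Dᶜ := by simpa [hD] using hbr
    rw [Finset.sum_eq_single_of_mem a haD, Finset.sum_eq_single_of_mem b hbD]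
    · intro v hv hvb
      exact key a haD v hv fun h => hvb h.2
    · intro u hu hua
      exact Finset.sum_eq_zero fun v hv => key u hu v hv fun h => hua h.1
  have htot : ∑ u ∈ D, (∑ v ∈ D, f u v + ∑ v ∈ Dᶜ, f u v) = 0 :=
    Finset.sum_eq_zero fun u _ => by rw [Finset.sum_add_sum_compl, hdiv]
  rw [Finset.sum_add_distrib, hDD, hcut, zero_add] at htot
  exact htot

lemma mem_eigSpace_iff {W : Type*} [Fintype W] {H : SimpleGraph W} {μ : ℝ} {x : W → ℝ} :
    x ∈ eigSpace H μ ↔ ∀ a, ∑ b, adjMat H a b * x b = μ * x a := by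
  simp only [eigSpace, LinearMap.mem_ker, LinearMap.sub_apply, sub_eq_zero, funext_iff]
  rfl

lemma isEigenvector_iff {W : Type*} [Fintype W] {H : SimpleGraph W} {μ : ℝ} {x : W → ℝ} :
    IsEigenvector H μ x ↔ x ≠ 0 ∧ x ∈ eigSpace H μ := by
  rw [mem_eigSpace_iff, IsEigenvector, funext_iff]
  rfl

lemma adjMat_comm {W : Type*} (H : SimpleGraph W) (a b : W) : adjMat H a b = adjMat H b a := by
  simp only [adjMat, H.adj_comm]

/-- On a tree, every element of an eigenspace is a multiple of a nowhere zero one. -/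
lemma SimpleGraph.IsTree.exists_eq_smul_of_mem_eigSpace {W : Type*} [Fintype W]
    {H : SimpleGraph W} (hH : H.IsTree) {μ : ℝ} {z w : W → ℝ} (hz : z ∈ eigSpace H μ)
    (hz0 : ∀ a, z a ≠ 0) (hw : w ∈ eigSpace H μ) : ∃ c : ℝ, w = c • z := by
  rw [mem_eigSpace_iff] at hz hw
  have hflow := hH.isAcyclic.flow_eq_zero
    (fun a b => adjMat H a b * (w a * z b - w b * z a))
    (fun a b => by rw [adjMat_comm H a b]; ring)
    (fun a b hab => by simp [adjMat, hab])
    (fun a => by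
      calc ∑ b, adjMat H a b * (w a * z b - w b * z a)
          = w a * ∑ b, adjMat H a b * z b - z a * ∑ b, adjMat H a b * w b := by
            rw [Finset.mul_sum, Finset.mul_sum, ← Finset.sum_sub_distrib]
            exact Finset.sum_congr rfl fun b _ => by ring
        _ = 0 := by rw [hz, hw]; ring)
  have hadj : ∀ a b, H.Adj a b → w a / z a = w b / z b := by
    intro a b hab
    have h := hflow a b
    simp only [adjMat, hab, if_true, one_mul] at h
    rw [div_eq_div_iff (hz0 a) (hz0 b)]
    linarith
  have hreach : ∀ a b, w a / z a = w b / z b := by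
    intro a b
    obtain ⟨p⟩ := hH.connected.preconnected a b
    induction p with
    | nil => rfl
    | cons h _ ih => exact (hadj _ _ h).trans ih
  obtain ⟨r⟩ := hH.connected.nonempty
  refine ⟨w r / z r, funext fun a => ?_⟩
  rw [Pi.smul_apply, smul_eq_mul, hreach r a, div_mul_cancel₀ _ (hz0 a)]

/-- The eigenspace of a tree containing a nowhere zero vector is spanned by it. -/
lemma SimpleGraph.IsTree.eigSpace_eq_span {W : Type*} [Fintype W]
    {H : SimpleGraph W} (hH : H.IsTree) {μ : ℝ} {z : W → ℝ} (hz : z ∈ eigSpace H μ)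
    (hz0 : ∀ a, z a ≠ 0) : eigSpace H μ = Submodule.span ℝ {z} := by
  refine le_antisymm (fun w hw => ?_) ((Submodule.span_singleton_le_iff_mem _ _).mpr hz)
  obtain ⟨c, hc⟩ := hH.exists_eq_smul_of_mem_eigSpace hz hz0 hw
  exact Submodule.mem_span_singleton.mpr ⟨c, hc.symm⟩

lemma IsCompOf.subset_s8 {V : Type*} {G : SimpleGraph V} {S C : Set V} (hC : IsCompOf G S C) :
    C ⊆ S := by
  obtain ⟨c, rfl⟩ := hC
  rintro _ ⟨v, _, rfl⟩
  exact v.2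

lemma IsCompOf.mem_of_adj_s8 {V : Type*} {G : SimpleGraph V} {S C : Set V} (hC : IsCompOf G S C)
    {u v : V} (hu : u ∈ C) (hv : v ∈ S) (huv : G.Adj u v) : v ∈ C := by
  obtain ⟨c, rfl⟩ := hC
  obtain ⟨u, hu, rfl⟩ := hu
  exact ⟨⟨v, hv⟩, ConnectedComponent.mem_supp_of_adj_mem_supp c hu huv, rfl⟩

lemma IsCompOf.connected {V : Type*} {G : SimpleGraph V} {S C : Set V} (hC : IsCompOf G S C) :
    (G.induce C).Connected := by
  obtain ⟨c, rfl⟩ := hC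
  exact c.connected_toSimpleGraph.map
    (f := ⟨fun v => ⟨v.1.1, v.1, v.2, rfl⟩, fun h => h⟩)
    (by rintro ⟨_, v, hv, rfl⟩; exact ⟨⟨v, hv⟩, rfl⟩)

/-- An eigenvector vanishing on all outside neighbours of `C` restricts to the eigenspace
of `G[C]`. -/
lemma restrict_mem_eigSpace {V : Type*} [Fintype V] {G : SimpleGraph V} {μ : ℝ} {y : V → ℝ}
    (hy : y ∈ eigSpace G μ) {C : Set V} [Fintype C]
    (hC : ∀ u ∈ C, ∀ v, G.Adj u v → v ∉ C → y v = 0) :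
    C.domRestrict y ∈ eigSpace (G.induce C) μ := by
  rw [mem_eigSpace_iff] at hy ⊢
  rintro ⟨a, ha⟩
  rw [Set.domRestrict_apply, ← hy a, ← Finset.sum_subset (Finset.subset_univ C.toFinset)]
  · exact (Finset.sum_subtype _ (fun _ => Set.mem_toFinset) fun b => adjMat G a b * y b).symm
  · intro v _ hv
    by_cases hav : G.Adj a v
    · rw [hC a ha v hav (by simpa using hv), mul_zero]
    · simp [adjMat, hav]

/-- A component of the complement of `N^C_μ(G)` lies inside `N_μ(G)` or is disjoint from it. -/
lemma IsCompOf.subset_or_disjoint_nSet {V : Type*} [Fintype V] {G : SimpleGraph V} {μ : ℝ}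
    {C : Set V} (hC : IsCompOf G (ncSet G μ)ᶜ C) :
    C ⊆ nSet G μ ∨ ∀ v ∈ C, v ∉ nSet G μ := by
  by_contra! h
  obtain ⟨h1, v, hvC, hvN⟩ := h
  obtain ⟨u, huC, huN⟩ := Set.not_subset.mp h1
  obtain ⟨p⟩ := hC.connected.preconnected ⟨v, hvC⟩ ⟨u, huC⟩
  have key : ∀ a b : C, (G.induce C).Walk a b → a.1 ∈ nSet G μ → b.1 ∈ nSet G μ := by
    intro a b p
    induction p with
    | nil => exact id
    | cons hadj _ ih =>
      intro ha
      refine ih ?_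
      by_contra hb
      exact hC.subset_s8 (Subtype.prop _) ⟨ha, _, hadj, hb⟩
  exact huN (key _ _ p hvN)

theorem stmt_8 {V : Type*} [Fintype V] (G : SimpleGraph V) (hT : G.IsTree) (μ : ℝ)
    (hμ : ∃ y, IsEigenvector G μ y) (x : V → ℝ) (hx : IsEigenvector G μ x)
    (C : Set V) (hC : IsCompOf G ((ncSet G μ)ᶜ) C) :
    (∀ v ∈ C, x v = 0) ∨
      ((∀ v ∈ C, x v ≠ 0) ∧
        eigSpace (G.induce C) μ = Submodule.span ℝ {C.restrict x} ∧
          Module.finrank ℝ (eigSpace (G.induce C) μ) = 1) := by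
  rcases hC.subset_or_disjoint_nSet with hN | hN
  · exact Or.inl fun v hv => hN hv x hx
  have hres : ∀ y ∈ eigSpace G μ, C.domRestrict y ∈ eigSpace (G.induce C) μ := by
    intro y hy
    refine restrict_mem_eigSpace hy fun u hu v huv hv => ?_
    have hv' : v ∈ ncSet G μ := by
      by_contra h
      exact hv (hC.mem_of_adj_s8 hu h huv)
    by_cases hy0 : y = 0
    · simp [hy0]
    · exact hv'.1 y (isEigenvector_iff.mpr ⟨hy0, hy⟩)
  have hT' : (G.induce C).IsTree := ⟨hC.connected, hT.isAcyclic.induce C⟩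
  obtain ⟨z, hz, hz0⟩ : ∃ z ∈ eigSpace G μ, ∀ v : C, z v ≠ 0 := by
    refine Module.Dual.exists_forall_mem_ne_zero_of_forall_exists (eigSpace G μ)
      (fun v : C => LinearMap.proj v.1) fun v => ?_
    have hv := hN v v.2
    simp only [nSet, Set.mem_ofPred_eq, not_forall] at hv
    obtain ⟨y, hy, hyv⟩ := hv
    exact ⟨y, (isEigenvector_iff.mp hy).2, hyv⟩
  have hxC := hres x (isEigenvector_iff.mp hx).2
  obtain ⟨c, hc⟩ := hT'.exists_eq_smul_of_mem_eigSpace (hres z hz) hz0 hxC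
  have hxv : ∀ v (hv : v ∈ C), x v = c * z v := fun v hv => congrFun hc ⟨v, hv⟩
  by_cases hc0 : c = 0
  · exact Or.inl fun v hv => by rw [hxv v hv, hc0, zero_mul]
  have hx0 : ∀ v ∈ C, x v ≠ 0 := fun v hv => by
    rw [hxv v hv]
    exact mul_ne_zero hc0 (hz0 ⟨v, hv⟩)
  have hspan := hT'.eigSpace_eq_span hxC fun v => hx0 v v.2
  refine Or.inr ⟨hx0, hspan, ?_⟩
  rw [hspan]
  obtain ⟨r⟩ := hC.connected.nonempty
  exact finrank_span_singleton fun h => hx0 r r.2 (congrFun h r)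
end
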